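/- Let E be a directed graph with E⁰ finite and K a field, let L = L_K(E) be the (unital) Leavitt path algebra, and let v be a vertex of E. Then the left ideal Lv is a simple (minimal) left ideal of L, i.e., Lv is nonzero and the only left ideals of L contained in Lv are 0 and Lv, if and only if v is a line point. -/

import Mathlib

/-- Generators for the Leavitt path algebra of a directed graph: one generator for each
vertex `v`, each edge `e`, and each ghost edge `e*`. -/
inductive LPAGen (V E : Type) : Type
  | vertex : V → LPAGen V E
  | edge : E → LPAGen V E
  | ghost : E → LPAGen V E

/-- The defining relations of the (unital) Leavitt path algebra of a directed graph
`(V, E, s, r)` with finitely many vertices, imposed on the free unital `K`-algebra on the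
generators; the relation `unit` makes the identity equal to the sum of the vertices. -/
inductive LPARel (K : Type) [Field K] (V E : Type) [Fintype V] (s r : E → V) :
    FreeAlgebra K (LPAGen V E) → FreeAlgebra K (LPAGen V E) → Prop
  | vertex_orth (v w : V) (h : v ≠ w) :
      LPARel K V E s r (FreeAlgebra.ι K (LPAGen.vertex v) * FreeAlgebra.ι K (LPAGen.vertex w)) 0
  | vertex_idem (v : V) :
      LPARel K V E s r (FreeAlgebra.ι K (LPAGen.vertex v) * FreeAlgebra.ι K (LPAGen.vertex v))
        (FreeAlgebra.ι K (LPAGen.vertex v))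
  | edge_src (e : E) :
      LPARel K V E s r (FreeAlgebra.ι K (LPAGen.vertex (s e)) * FreeAlgebra.ι K (LPAGen.edge e))
        (FreeAlgebra.ι K (LPAGen.edge e))
  | edge_rng (e : E) :
      LPARel K V E s r (FreeAlgebra.ι K (LPAGen.edge e) * FreeAlgebra.ι K (LPAGen.vertex (r e)))
        (FreeAlgebra.ι K (LPAGen.edge e))
  | ghost_rng (e : E) :
      LPARel K V E s r (FreeAlgebra.ι K (LPAGen.vertex (r e)) * FreeAlgebra.ι K (LPAGen.ghost e))
        (FreeAlgebra.ι K (LPAGen.ghost e))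
  | ghost_src (e : E) :
      LPARel K V E s r (FreeAlgebra.ι K (LPAGen.ghost e) * FreeAlgebra.ι K (LPAGen.vertex (s e)))
        (FreeAlgebra.ι K (LPAGen.ghost e))
  | ck1_distinct (e f : E) (h : e ≠ f) :
      LPARel K V E s r (FreeAlgebra.ι K (LPAGen.ghost e) * FreeAlgebra.ι K (LPAGen.edge f)) 0
  | ck1_same (e : E) :
      LPARel K V E s r (FreeAlgebra.ι K (LPAGen.ghost e) * FreeAlgebra.ι K (LPAGen.edge e))
        (FreeAlgebra.ι K (LPAGen.vertex (r e)))
  | ck2 (v : V) (h : {e : E | s e = v}.Finite) (hne : {e : E | s e = v}.Nonempty) :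
      LPARel K V E s r (FreeAlgebra.ι K (LPAGen.vertex v))
        (∑ e ∈ h.toFinset, FreeAlgebra.ι K (LPAGen.edge e) * FreeAlgebra.ι K (LPAGen.ghost e))
  | unit :
      LPARel K V E s r 1 (∑ v : V, FreeAlgebra.ι K (LPAGen.vertex v))

/-- The unital Leavitt path algebra `L_K(E)` of a directed graph with finitely many
vertices, as the quotient of the free unital `K`-algebra on the generators by the
defining relations. -/
abbrev LeavittPathAlgebra (K : Type) [Field K] (V E : Type) [Fintype V] (s r : E → V) :=
  RingQuot (LPARel K V E s r)

/-- A list of edges is a path chain if the range of each edge is the source of the next. -/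
def IsPathChain {V E : Type} (s r : E → V) (es : List E) : Prop :=
  ∀ (i : ℕ) (h : i + 1 < es.length), r (es[i]'(by omega)) = s (es[i+1]'h)

/-- A nonempty list of edges is a cycle if it is a closed path chain whose sources are
pairwise distinct. -/
def IsCycle {V E : Type} (s r : E → V) (es : List E) : Prop :=
  ∃ hne : es ≠ [], IsPathChain s r es ∧ r (es.getLast hne) = s (es.head hne) ∧
    (es.map s).Nodup

/-- A path (given as a list of edges) has an exit if some edge `f` has the same source as
one of the edges of the path but differs from it. -/
def HasExit {V E : Type} (s r : E → V) (es : List E) : Prop :=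
  ∃ (f : E) (i : ℕ) (h : i < es.length), s f = s (es[i]'h) ∧ f ≠ es[i]'h


/-- `Reaches s r v w` means there is a (possibly length-zero) path in the graph from `v`
to `w`; so `T(v) = {w | Reaches s r v w}` is the tree of `v`. -/
def Reaches {V E : Type} (s r : E → V) : V → V → Prop :=
  Relation.ReflTransGen (fun a b => ∃ e : E, s e = a ∧ r e = b)

/-- A vertex `v` is a line point if no vertex in the tree `T(v)` of `v` is a bifurcation
vertex (emits two distinct edges) and no cycle is based at a vertex of `T(v)`. -/
def IsLinePoint {V E : Type} (s r : E → V) (v : V) : Prop :=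
  ∀ w : V, Reaches s r v w →
    (¬ ∃ e f : E, e ≠ f ∧ s e = w ∧ s f = w) ∧
    (¬ ∃ es : List E, IsCycle s r es ∧ ∃ hne : es ≠ [], s (es.head hne) = w)

/-- The image of the vertex generator `v` in the unital Leavitt path algebra. -/
def lpaVertex (K : Type) [Field K] {V E : Type} [Fintype V] (s r : E → V) (v : V) :
    LeavittPathAlgebra K V E s r :=
  RingQuot.mkRingHom (LPARel K V E s r) (FreeAlgebra.ι K (LPAGen.vertex v))

namespace LPAProof

variable {K V E : Type} [Field K] [Fintype V] {s r : E → V}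

section basics

/-- Image of an edge. -/
noncomputable def ed (K : Type) [Field K] {V E : Type} [Fintype V] (s r : E → V) (e : E) :
    LeavittPathAlgebra K V E s r :=
  RingQuot.mkAlgHom K (LPARel K V E s r) (FreeAlgebra.ι K (LPAGen.edge e))

/-- Image of a ghost edge. -/
noncomputable def gh (K : Type) [Field K] {V E : Type} [Fintype V] (s r : E → V) (e : E) :
    LeavittPathAlgebra K V E s r :=
  RingQuot.mkAlgHom K (LPARel K V E s r) (FreeAlgebra.ι K (LPAGen.ghost e))

/-- Image of a vertex. -/
noncomputable def vx (K : Type) [Field K] {V E : Type} [Fintype V] (s r : E → V) (v : V) :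
    LeavittPathAlgebra K V E s r :=
  RingQuot.mkAlgHom K (LPARel K V E s r) (FreeAlgebra.ι K (LPAGen.vertex v))

theorem lpaVertex_eq (v : V) : lpaVertex K s r v = vx K s r v := by
  unfold lpaVertex vx
  rw [← RingQuot.mkAlgHom_coe K]
  rfl

theorem vx_orth {v w : V} (h : v ≠ w) : vx K s r v * vx K s r w = 0 := by
  have := RingQuot.mkAlgHom_rel K (LPARel.vertex_orth (K := K) (s := s) (r := r) v w h)
  simpa [vx] using this

theorem vx_idem (v : V) : vx K s r v * vx K s r v = vx K s r v := by
  have := RingQuot.mkAlgHom_rel K (LPARel.vertex_idem (K := K) (s := s) (r := r) v)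
  simpa [vx] using this

theorem vx_ed (e : E) : vx K s r (s e) * ed K s r e = ed K s r e := by
  have := RingQuot.mkAlgHom_rel K (LPARel.edge_src (K := K) (s := s) (r := r) e)
  simpa [vx, ed] using this

theorem ed_vx (e : E) : ed K s r e * vx K s r (r e) = ed K s r e := by
  have := RingQuot.mkAlgHom_rel K (LPARel.edge_rng (K := K) (s := s) (r := r) e)
  simpa [vx, ed] using this

theorem vx_gh (e : E) : vx K s r (r e) * gh K s r e = gh K s r e := by
  have := RingQuot.mkAlgHom_rel K (LPARel.ghost_rng (K := K) (s := s) (r := r) e)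
  simpa [vx, gh] using this

theorem gh_vx (e : E) : gh K s r e * vx K s r (s e) = gh K s r e := by
  have := RingQuot.mkAlgHom_rel K (LPARel.ghost_src (K := K) (s := s) (r := r) e)
  simpa [vx, gh] using this

theorem gh_ed_ne {e f : E} (h : e ≠ f) : gh K s r e * ed K s r f = 0 := by
  have := RingQuot.mkAlgHom_rel K (LPARel.ck1_distinct (K := K) (s := s) (r := r) e f h)
  simpa [gh, ed] using this

theorem gh_ed (e : E) : gh K s r e * ed K s r e = vx K s r (r e) := by
  have := RingQuot.mkAlgHom_rel K (LPARel.ck1_same (K := K) (s := s) (r := r) e)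
  simpa [vx, ed, gh] using this

theorem ed_gh_unique (e : E) (h : ∀ f, s f = s e → f = e) :
    ed K s r e * gh K s r e = vx K s r (s e) := by
  have hs : {f : E | s f = s e} = {e} := by
    ext f; simp only [Set.mem_ofPred_eq, Set.mem_singleton_iff]
    exact ⟨h f, fun h => by rw [h]⟩
  have hf : {f : E | s f = s e}.Finite := by rw [hs]; exact Set.finite_singleton e
  have := RingQuot.mkAlgHom_rel K (LPARel.ck2 (K := K) (s := s) (r := r) (s e) hf ⟨e, rfl⟩)
  have h2 : hf.toFinset = {e} := by
    ext f; simp only [Set.Finite.mem_toFinset, hs, Set.mem_singleton_iff, Finset.mem_singleton]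
  rw [h2, Finset.sum_singleton] at this
  simpa [vx, ed, gh] using this.symm

/-- A `K`-subspace closed under left multiplication by the generators is a left ideal. -/
theorem mul_mem_of_gens (N : Submodule K (LeavittPathAlgebra K V E s r))
    (hv : ∀ v, ∀ y ∈ N, vx K s r v * y ∈ N) (he : ∀ e, ∀ y ∈ N, ed K s r e * y ∈ N)
    (hg : ∀ e, ∀ y ∈ N, gh K s r e * y ∈ N) (x : LeavittPathAlgebra K V E s r) :
    ∀ y ∈ N, x * y ∈ N := by
  obtain ⟨a, rfl⟩ := RingQuot.mkAlgHom_surjective K (LPARel K V E s r) x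
  induction a using FreeAlgebra.induction with
  | grade0 k =>
    intro y hy
    rw [AlgHom.commutes, ← Algebra.smul_def]
    exact N.smul_mem _ hy
  | grade1 g =>
    cases g with
    | vertex v => exact hv v
    | edge e => exact he e
    | ghost e => exact hg e
  | mul a b ha hb =>
    intro y hy
    rw [map_mul, mul_assoc]
    exact ha _ (hb _ hy)
  | add a b ha hb =>
    intro y hy
    rw [map_add, add_mul]
    exact N.add_mem (ha _ hy) (hb _ hy)

end basics

section rep

open Classical in
theorem exists_rep (K : Type) [Field K] {V E : Type} [Fintype V] (s r : E → V)
    {S : Type} (b : E → S → S)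
    (inj : ∀ e f x y, s e = s f → b e x = b f y → e = f ∧ x = y)
    (surj : ∀ e x, ∃ f y, s f = s e ∧ b f y = x) :
    ∃ ρ : LeavittPathAlgebra K V E s r →ₐ[K] Module.End K (V × S →₀ K),
      (∀ v u x, ρ (vx K s r v) (Finsupp.single (u, x) 1) =
        if u = v then Finsupp.single (u, x) 1 else 0) ∧
      (∀ e u x, ρ (ed K s r e) (Finsupp.single (u, x) 1) =
        if u = r e then Finsupp.single (s e, b e x) 1 else 0) := by
  let fv : V → Module.End K (V × S →₀ K) := fun v =>
    Finsupp.linearCombination K (fun p : V × S => if p.1 = v then Finsupp.single p (1 : K) else 0)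
  let fe : E → Module.End K (V × S →₀ K) := fun e =>
    Finsupp.linearCombination K
      (fun p : V × S => if p.1 = r e then Finsupp.single (s e, b e p.2) (1 : K) else 0)
  let fg : E → Module.End K (V × S →₀ K) := fun e =>
    Finsupp.linearCombination K
      (fun p : V × S => if h : p.1 = s e ∧ ∃ y, b e y = p.2 then
        Finsupp.single (r e, h.2.choose) (1 : K) else 0)
  have hv : ∀ v u x, fv v (Finsupp.single (u, x) 1) =
      if u = v then Finsupp.single (u, x) 1 else 0 := by
    intro v u x; simp [fv, Finsupp.linearCombination_single]
  have he : ∀ e u x, fe e (Finsupp.single (u, x) 1) =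
      if u = r e then Finsupp.single (s e, b e x) 1 else 0 := by
    intro v u x; simp [fe, Finsupp.linearCombination_single]
  have hg0 : ∀ e u x, ¬ (u = s e ∧ ∃ y, b e y = x) → fg e (Finsupp.single (u, x) 1) = 0 := by
    intro e u x h
    simp only [fg, Finsupp.linearCombination_single, one_smul]
    rw [dif_neg h]
  have hg1 : ∀ e y, fg e (Finsupp.single (s e, b e y) 1) = Finsupp.single (r e, y) 1 := by
    intro e y
    have h : s e = s e ∧ ∃ z, b e z = b e y := ⟨rfl, y, rfl⟩
    have h1 : fg e (Finsupp.single (s e, b e y) 1) = Finsupp.single (r e, h.2.choose) 1 := by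
      change Finsupp.linearCombination K _ _ = _
      rw [Finsupp.linearCombination_single, one_smul]
      exact dif_pos h
    rw [h1, (inj e e _ _ rfl h.2.choose_spec).2]
  let F : FreeAlgebra K (LPAGen V E) →ₐ[K] Module.End K (V × S →₀ K) :=
    FreeAlgebra.lift K (fun g => match g with
      | LPAGen.vertex v => fv v
      | LPAGen.edge e => fe e
      | LPAGen.ghost e => fg e)
  have Fv : ∀ v, F (FreeAlgebra.ι K (LPAGen.vertex v)) = fv v := fun v => by simp [F]
  have Fe : ∀ e, F (FreeAlgebra.ι K (LPAGen.edge e)) = fe e := fun v => by simp [F]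
  have Fg : ∀ e, F (FreeAlgebra.ι K (LPAGen.ghost e)) = fg e := fun v => by simp [F]
  have key : ∀ A B : Module.End K (V × S →₀ K),
      (∀ u x, A (Finsupp.single (u, x) 1) = B (Finsupp.single (u, x) 1)) → A = B := by
    intro A B h
    refine Finsupp.lhom_ext' fun p => LinearMap.ext_ring ?_
    exact h p.1 p.2
  have hF : ∀ ⦃x y⦄, LPARel K V E s r x y → F x = F y := by
    intro x y hxy
    apply key
    intro u x
    cases hxy with
    | vertex_orth v w h =>
      simp only [map_mul, Fv, Module.End.mul_apply, hv, map_zero, LinearMap.zero_apply]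
      split_ifs with h1
      · rw [hv, if_neg (by rintro rfl; exact h h1)]
      · simp
    | vertex_idem v =>
      simp only [map_mul, Fv, Module.End.mul_apply, hv]
      split_ifs with h1
      · rw [hv, if_pos h1]
      · simp
    | edge_src e =>
      simp only [map_mul, Fv, Fe, Module.End.mul_apply, he]
      split_ifs with h1
      · rw [hv, if_pos rfl]
      · simp
    | edge_rng e =>
      simp only [map_mul, Fv, Fe, Module.End.mul_apply, hv, he]
      split_ifs with h1
      · rw [he, if_pos h1]
      · simp
    | ghost_rng e =>
      simp only [map_mul, Fv, Fg, Module.End.mul_apply]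
      by_cases h : u = s e ∧ ∃ y, b e y = x
      · obtain ⟨rfl, y, rfl⟩ := h
        rw [hg1, hv, if_pos rfl]
      · rw [hg0 _ _ _ h, map_zero]
    | ghost_src e =>
      simp only [map_mul, Fv, Fg, Module.End.mul_apply, hv]
      split_ifs with h1
      · rfl
      · rw [map_zero, hg0]
        exact fun h => h1 h.1
    | ck1_distinct e f h =>
      simp only [map_mul, Fe, Fg, Module.End.mul_apply, he, map_zero, LinearMap.zero_apply]
      split_ifs with h1
      · apply hg0
        rintro ⟨h2, y, h3⟩
        exact h (inj e f _ _ h2.symm h3).1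
      · simp
    | ck1_same e =>
      simp only [map_mul, Fe, Fv, Fg, Module.End.mul_apply, he, hv]
      split_ifs with h1
      · rw [hg1, h1]
      · simp
    | ck2 v h hne =>
      simp only [map_sum, map_mul, Fe, Fv, Fg, hv, LinearMap.sum_apply, Module.End.mul_apply]
      split_ifs with h1
      · subst h1
        obtain ⟨e0, h0⟩ := hne
        obtain ⟨f, y, h2, h3⟩ := surj e0 x
        have h4 : s f = u := h2.trans h0
        rw [Finset.sum_eq_single f]
        · rw [← h3, ← h4, hg1, he, if_pos rfl]
        · intro e _ hef
          rw [hg0, map_zero]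
          rintro ⟨h5, z, h6⟩
          exact hef (inj e f z y (by rw [h4, ← h5]) (by rw [h6, h3])).1
        · intro h5
          exact absurd (by simpa using h4) h5
      · symm
        apply Finset.sum_eq_zero
        intro e hee
        rw [hg0, map_zero]
        rintro ⟨h5, -⟩
        have : s e = v := by simpa using hee
        exact h1 (h5.trans this)
    | unit =>
      simp only [map_one, map_sum, Fv, LinearMap.sum_apply, hv, Module.End.one_apply]
      simp
  refine ⟨RingQuot.liftAlgHom K ⟨F, hF⟩, ?_, ?_⟩
  · intro v u x
    rw [← hv, ← Fv, vx, RingQuot.liftAlgHom_mkAlgHom_apply]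
  · intro v u x
    rw [← he, ← Fe, ed, RingQuot.liftAlgHom_mkAlgHom_apply]

open Classical in
/-- Existence of branching data, with prescribed bijections at edges that are the unique edge
of their source. -/
theorem exists_branch {V E : Type} (s : E → V) (τ : E → Equiv.Perm (ℕ ⊕ E)) :
    ∃ b : E → (ℕ ⊕ E) → (ℕ ⊕ E),
      (∀ e f x y, s e = s f → b e x = b f y → e = f ∧ x = y) ∧
      (∀ e x, ∃ f y, s f = s e ∧ b f y = x) ∧
      (∀ e x, (∀ f, s f = s e → f = e) → b e x = τ e x) := by
  have hφ : ∀ v : V, (∃ e, s e = v) → Nonempty ({e : E // s e = v} × (ℕ ⊕ E) ≃ (ℕ ⊕ E)) := by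
    rintro v ⟨e, he⟩
    rw [← Cardinal.eq, Cardinal.mk_prod, Cardinal.lift_id, Cardinal.lift_id]
    apply Cardinal.mul_eq_right
    · exact Cardinal.aleph0_le_mk _
    · refine le_trans (Cardinal.mk_subtype_le _) ?_
      exact Cardinal.mk_le_of_injective (f := Sum.inr) Sum.inr_injective
    · have : Nonempty {e : E // s e = v} := ⟨⟨e, he⟩⟩
      exact Cardinal.mk_ne_zero _
  let φ : ∀ e : E, {f : E // s f = s e} × (ℕ ⊕ E) ≃ (ℕ ⊕ E) := fun e =>
    (hφ (s e) ⟨e, rfl⟩).some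
  have φ_eq : ∀ e f (h : s e = s f) (x), φ e (⟨e, rfl⟩, x) = φ f (⟨e, h⟩, x) := by
    have gen : ∀ (v w : V) (hv : ∃ e, s e = v) (hw : ∃ e, s e = w) (h : v = w) (e : E)
        (he : s e = v) (x),
        (hφ v hv).some (⟨e, he⟩, x) = (hφ w hw).some (⟨e, he.trans h⟩, x) := by
      intro v w hv hw h e he x
      subst h
      rfl
    intro e f h x
    exact gen _ _ ⟨e, rfl⟩ ⟨f, rfl⟩ h _ _ _
  refine ⟨fun e x => if (∀ f, s f = s e → f = e) then τ e x else φ e (⟨e, rfl⟩, x), ?_, ?_, ?_⟩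
  · intro e f x y hs hb
    by_cases he : ∀ g, s g = s e → g = e
    · have hfe := he f hs.symm
      subst hfe
      simp only [if_pos he] at hb
      exact ⟨rfl, (τ f).injective hb⟩
    · have hf : ¬ ∀ g, s g = s f → g = f := by
        intro hf
        have hfe := hf e hs
        subst hfe
        exact he hf
      simp only [if_neg he, if_neg hf] at hb
      rw [φ_eq e f hs] at hb
      have := (φ f).injective hb
      simp only [Prod.mk.injEq, Subtype.mk.injEq] at this
      exact this
  · intro e x
    by_cases he : ∀ g, s g = s e → g = e
    · exact ⟨e, (τ e).symm x, rfl, by simp only [if_pos he, Equiv.apply_symm_apply]⟩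
    · obtain ⟨⟨⟨f, hf⟩, y⟩, hfy⟩ := (φ e).surjective x
      refine ⟨f, y, hf, ?_⟩
      have hf' : ¬ ∀ g, s g = s f → g = f := by
        intro h
        have hfe := h e hf.symm
        subst hfe
        exact he h
      simp only [if_neg hf']
      rw [φ_eq f e hf, hfy]
  · intro e x h
    simp only [if_pos h]

theorem vx_ne_zero (v : V) : vx K s r v ≠ 0 := by
  obtain ⟨b, inj, surj, -⟩ := exists_branch s (fun _ => 1)
  obtain ⟨ρ, hv, -⟩ := exists_rep K s r b inj surj
  intro h
  have := hv v v (Sum.inl 0)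
  rw [h, map_zero, if_pos rfl] at this
  exact one_ne_zero (Finsupp.single_eq_zero.1 this.symm)

end rep

/-- Elementwise minimality of `L v`. -/
def Q (K : Type) [Field K] {V E : Type} [Fintype V] (s r : E → V) (v : V) : Prop :=
  ∀ x : LeavittPathAlgebra K V E s r, x * vx K s r v ≠ 0 → ∃ a, a * (x * vx K s r v) = vx K s r v

theorem simple_iff (v : V) :
    (Submodule.span (LeavittPathAlgebra K V E s r) {lpaVertex K s r v} ≠ ⊥ ∧
      ∀ I : Submodule (LeavittPathAlgebra K V E s r) (LeavittPathAlgebra K V E s r),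
        I ≤ Submodule.span (LeavittPathAlgebra K V E s r) {lpaVertex K s r v} →
          I = ⊥ ∨ I = Submodule.span (LeavittPathAlgebra K V E s r) {lpaVertex K s r v}) ↔
      Q K s r v := by
  rw [lpaVertex_eq]
  constructor
  · rintro ⟨-, h⟩ x hx
    have hle : Submodule.span (LeavittPathAlgebra K V E s r) {x * vx K s r v} ≤
        Submodule.span (LeavittPathAlgebra K V E s r) {vx K s r v} := by
      rw [Submodule.span_singleton_le_iff_mem]
      exact Submodule.mem_span_singleton.2 ⟨x, rfl⟩
    rcases h _ hle with h | h
    · exact absurd (Submodule.span_singleton_eq_bot.1 h) hx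
    · have : vx K s r v ∈ Submodule.span (LeavittPathAlgebra K V E s r) {x * vx K s r v} := by
        rw [h]; exact Submodule.mem_span_singleton_self _
      obtain ⟨a, ha⟩ := Submodule.mem_span_singleton.1 this
      exact ⟨a, ha⟩
  · intro h
    refine ⟨fun h0 => vx_ne_zero v (Submodule.span_singleton_eq_bot.1 h0), fun I hI => ?_⟩
    by_cases hb : I = ⊥
    · exact Or.inl hb
    · right
      obtain ⟨y, hy, hy0⟩ := Submodule.exists_mem_ne_zero_of_ne_bot hb
      obtain ⟨x, rfl⟩ := Submodule.mem_span_singleton.1 (hI hy)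
      obtain ⟨a, ha⟩ := h x hy0
      refine le_antisymm hI ?_
      rw [Submodule.span_singleton_le_iff_mem, ← ha]
      exact I.smul_mem a hy

theorem Q_range (e : E) (h : Q K s r (s e)) : Q K s r (r e) := by
  intro x hx
  have h1 : x * gh K s r e * vx K s r (s e) = x * gh K s r e := by rw [mul_assoc, gh_vx]
  have h2 : x * gh K s r e * ed K s r e = x * vx K s r (r e) := by rw [mul_assoc, gh_ed]
  obtain ⟨a, ha⟩ := h (x * gh K s r e) (by
    rw [h1]; intro h0; rw [h0, zero_mul] at h2; exact hx h2.symm)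
  rw [h1] at ha
  refine ⟨gh K s r e * a, ?_⟩
  rw [← h2, mul_assoc, ← mul_assoc a, ha, vx_ed, gh_ed]

theorem Q_source (e : E) (hu : ∀ f, s f = s e → f = e) (h : Q K s r (r e)) : Q K s r (s e) := by
  have hv := ed_gh_unique (K := K) (s := s) (r := r) e hu
  intro x hx
  have h1 : x * ed K s r e * vx K s r (r e) = x * ed K s r e := by rw [mul_assoc, ed_vx]
  have h2 : x * ed K s r e * gh K s r e = x * vx K s r (s e) := by rw [mul_assoc, hv]
  obtain ⟨a, ha⟩ := h (x * ed K s r e) (by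
    rw [h1]; intro h0; rw [h0, zero_mul] at h2; exact hx h2.symm)
  rw [h1] at ha
  refine ⟨ed K s r e * a, ?_⟩
  rw [← h2, mul_assoc, ← mul_assoc a, ha, vx_gh, hv]

theorem Q_reaches {v w : V} (h : Reaches s r v w) (hv : Q K s r v) : Q K s r w := by
  induction h with
  | refl => exact hv
  | tail _ h ih =>
    obtain ⟨e, rfl, rfl⟩ := h
    exact Q_range e ih

theorem Q_no_bif {e f : E} (hef : e ≠ f) (hs : s f = s e) (h : Q K s r (s e)) : False := by
  obtain ⟨a, ha⟩ := h (gh K s r e) (by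
    rw [gh_vx]; intro h0
    have := gh_ed (K := K) (s := s) (r := r) e
    rw [h0, zero_mul] at this
    exact vx_ne_zero _ this.symm)
  rw [gh_vx] at ha
  have h1 := vx_ed (K := K) (s := s) (r := r) f
  rw [hs, ← ha, mul_assoc, gh_ed_ne hef, mul_zero] at h1
  have := gh_ed (K := K) (s := s) (r := r) f
  rw [← h1, mul_zero] at this
  exact vx_ne_zero _ this.symm

section sink

/-- Path elements ending in `w`. -/
noncomputable def pth (K : Type) [Field K] {V E : Type} [Fintype V] (s r : E → V) (w : V) :
    List E → LeavittPathAlgebra K V E s r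
  | [] => vx K s r w
  | e :: l => ed K s r e * pth K s r w l

/-- Ghost path elements. -/
noncomputable def gst (K : Type) [Field K] {V E : Type} [Fintype V] (s r : E → V) (w : V) :
    List E → LeavittPathAlgebra K V E s r
  | [] => vx K s r w
  | e :: l => gst K s r w l * gh K s r e

theorem vx_mul_ed_ne {u : V} {e : E} (h : u ≠ s e) : vx K s r u * ed K s r e = 0 := by
  rw [← vx_ed, ← mul_assoc, vx_orth h, zero_mul]

theorem gh_mul_vx_ne {u : V} {e : E} (h : s e ≠ u) : gh K s r e * vx K s r u = 0 := by
  rw [← gh_vx, mul_assoc, vx_orth h, mul_zero]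

theorem vx_pth (w u : V) (l : List E) :
    vx K s r u * pth K s r w l = pth K s r w l ∨ vx K s r u * pth K s r w l = 0 := by
  cases l with
  | nil =>
    by_cases h : u = w
    · subst h; exact Or.inl (vx_idem _)
    · exact Or.inr (vx_orth h)
  | cons e l =>
    simp only [pth, ← mul_assoc]
    by_cases h : u = s e
    · subst h; left; rw [vx_ed]
    · right; rw [vx_mul_ed_ne h, zero_mul]

variable {w : V}

theorem gst_pth_ne (hw : ∀ e, s e ≠ w) : ∀ l l' : List E, l ≠ l' → gst K s r w l * pth K s r w l' = 0
  | [], [], h => absurd rfl h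
  | [], e :: l', _ => by
    simp only [gst, pth, ← mul_assoc]
    rw [vx_mul_ed_ne (hw e).symm, zero_mul]
  | e :: l, [], _ => by
    simp only [gst, pth, mul_assoc]
    rw [gh_mul_vx_ne (hw e), mul_zero]
  | e :: l, f :: l', h => by
    have h0 : gst K s r w (e :: l) * pth K s r w (f :: l') =
        gst K s r w l * (gh K s r e * ed K s r f * pth K s r w l') := by
      simp only [gst, pth, mul_assoc]
    rw [h0]
    by_cases hef : e = f
    · subst hef
      rw [gh_ed]
      rcases vx_pth (K := K) (s := s) (r := r) w (r e) l' with h1 | h1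
      · rw [h1]
        exact gst_pth_ne hw l l' (fun h2 => h (by rw [h2]))
      · rw [h1, mul_zero]
    · rw [gh_ed_ne hef, zero_mul, mul_zero]

theorem gst_pth_self : ∀ l : List E, pth K s r w l ≠ 0 →
    gst K s r w l * pth K s r w l = vx K s r w
  | [], _ => vx_idem w
  | e :: l, h => by
    have h0 : gst K s r w (e :: l) * pth K s r w (e :: l) =
        gst K s r w l * (gh K s r e * ed K s r e * pth K s r w l) := by
      simp only [gst, pth, mul_assoc]
    rw [h0, gh_ed]
    rcases vx_pth (K := K) (s := s) (r := r) w (r e) l with h1 | h1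
    · rw [h1]
      refine gst_pth_self l fun h2 => h ?_
      simp only [pth, h2, mul_zero]
    · exfalso
      apply h
      simp only [pth]
      rw [← ed_vx, mul_assoc, h1, mul_zero]

theorem mem_span_pth (hw : ∀ e, s e ≠ w) (x : LeavittPathAlgebra K V E s r) :
    x * vx K s r w ∈ Submodule.span K (Set.range (pth K s r w)) := by
  have ext : ∀ g : LeavittPathAlgebra K V E s r,
      (∀ l, g * pth K s r w l ∈ Submodule.span K (Set.range (pth K s r w))) →
      ∀ y ∈ Submodule.span K (Set.range (pth K s r w)),
        g * y ∈ Submodule.span K (Set.range (pth K s r w)) := by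
    intro g hg y hy
    have : Submodule.span K (Set.range (pth K s r w)) ≤
        (Submodule.span K (Set.range (pth K s r w))).comap (LinearMap.mulLeft K g) := by
      rw [Submodule.span_le]
      rintro _ ⟨l, rfl⟩
      exact hg l
    exact this hy
  have mem : ∀ l, pth K s r w l ∈ Submodule.span K (Set.range (pth K s r w)) :=
    fun l => Submodule.subset_span ⟨l, rfl⟩
  have hv : ∀ u l, vx K s r u * pth K s r w l ∈ Submodule.span K (Set.range (pth K s r w)) := by
    intro u l
    rcases vx_pth (K := K) (s := s) (r := r) w u l with h1 | h1
    · rw [h1]; exact mem l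
    · rw [h1]; exact Submodule.zero_mem _
  refine mul_mem_of_gens _ (fun u => ext _ (hv u)) (fun e => ext _ fun l => mem (e :: l))
    (fun e => ext _ fun l => ?_) x _ (mem [])
  cases l with
  | nil =>
    simp only [pth]
    rw [gh_mul_vx_ne (hw e)]
    exact Submodule.zero_mem _
  | cons f l =>
    simp only [pth]
    rw [← mul_assoc]
    by_cases hef : e = f
    · subst hef
      rw [gh_ed]
      exact hv _ _
    · rw [gh_ed_ne hef, zero_mul]
      exact Submodule.zero_mem _

theorem Q_sink (hw : ∀ e, s e ≠ w) : Q K s r w := by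
  intro x hx
  obtain ⟨c, hc⟩ := Finsupp.mem_span_range_iff_exists_finsupp.1 (mem_span_pth (K := K) (r := r) hw x)
  rw [← hc] at hx ⊢
  obtain ⟨l, hl, hl0⟩ := Finset.exists_ne_zero_of_sum_ne_zero hx
  change c l • pth K s r w l ≠ 0 at hl0
  have hp : pth K s r w l ≠ 0 := fun h => hl0 (by rw [h, smul_zero])
  have hk : c l ≠ 0 := fun h => hl0 (by rw [h, zero_smul])
  refine ⟨(c l)⁻¹ • gst K s r w l, ?_⟩
  rw [Finsupp.sum, Finset.mul_sum, Finset.sum_eq_single l]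
  · rw [smul_mul_smul_comm, inv_mul_cancel₀ hk, one_smul, gst_pth_self l hp]
  · intro l' _ hne
    rw [smul_mul_smul_comm, gst_pth_ne hw l l' hne.symm, smul_zero]
  · intro h; exact absurd hl h

end sink

section graph

/-- `PathTo a b l`: the list `l` is a path from `a` to `b`. -/
def PathTo (s r : E → V) (b : V) : V → List E → Prop
  | a, [] => a = b
  | a, e :: l => s e = a ∧ PathTo s r b (r e) l

theorem PathTo.suffix {b : V} {e : E} : ∀ {l1 l2 : List E} {a : V},
    PathTo s r b a (l1 ++ e :: l2) → PathTo s r b (s e) (e :: l2)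
  | [], _, _, h => ⟨rfl, h.2⟩
  | _ :: _, _, _, h => PathTo.suffix h.2

theorem exists_simple_path {a b : V} (h : Reaches s r a b) :
    ∃ l, PathTo s r b a l ∧ (l.map s).Nodup ∧ b ∉ l.map s := by
  induction h using Relation.ReflTransGen.head_induction_on with
  | refl => exact ⟨[], rfl, List.nodup_nil, by simp⟩
  | head h _ ih =>
    obtain ⟨e, rfl, rfl⟩ := h
    obtain ⟨l, hl, hn, hb⟩ := ih
    by_cases hab : s e = b
    · exact ⟨[], hab, List.nodup_nil, by simp⟩
    by_cases hm : s e ∈ l.map s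
    · obtain ⟨f, hf, hfe⟩ := List.mem_map.1 hm
      obtain ⟨l1, l2, rfl⟩ := List.append_of_mem hf
      refine ⟨f :: l2, hfe ▸ hl.suffix, ?_, ?_⟩
      · rw [List.map_append] at hn
        exact (List.nodup_append.1 hn).2.1
      · intro h
        apply hb
        rw [List.map_append]
        exact List.mem_append_right _ h
    · refine ⟨e :: l, ⟨rfl, hl⟩, ?_, ?_⟩
      · rw [List.map_cons, List.nodup_cons]; exact ⟨hm, hn⟩
      · rw [List.map_cons, List.mem_cons]
        rintro (h | h)
        · exact hab h.symm
        · exact hb h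

theorem isPathChain_cons {e : E} {l : List E} :
    IsPathChain s r (e :: l) ↔ (∀ h : l ≠ [], r e = s (l.head h)) ∧ IsPathChain s r l := by
  constructor
  · intro h
    refine ⟨fun hl => ?_, fun i hi => ?_⟩
    · cases l with
      | nil => exact absurd rfl hl
      | cons f l => exact h 0 (by simp)
    · exact h (i + 1) (by simpa using hi)
  · rintro ⟨h1, h2⟩ i hi
    cases i with
    | zero =>
      cases l with
      | nil => simp at hi
      | cons f l => exact h1 (by simp)
    | succ i => exact h2 i (by simpa using hi)

/-- A nonempty list is a path iff it is a chain with the right endpoints. -/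
theorem pathTo_cons_iff {b : V} : ∀ {e : E} {l : List E},
    PathTo s r b (s e) (e :: l) ↔
      IsPathChain s r (e :: l) ∧ r ((e :: l).getLast (by simp)) = b
  | e, [] => by
    simp [PathTo, IsPathChain]
  | e, f :: l => by
    rw [isPathChain_cons]
    have ih := @pathTo_cons_iff b f l
    constructor
    · rintro ⟨-, h⟩
      have h1 : s f = r e := h.1
      rw [← h1] at h
      have h2 := ih.1 h
      refine ⟨⟨fun _ => h1.symm, h2.1⟩, ?_⟩
      rw [List.getLast_cons (by simp)]
      exact h2.2
    · rintro ⟨⟨h1, h2⟩, h3⟩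
      rw [List.getLast_cons (by simp)] at h3
      refine ⟨rfl, ?_⟩
      have := ih.2 ⟨h2, h3⟩
      have h4 : r e = s f := h1 (by simp)
      rw [h4]
      exact this

theorem exists_cycle {e : E} (h : Reaches s r (r e) (s e)) :
    ∃ es : List E, IsCycle s r es ∧ ∃ hne : es ≠ [], s (es.head hne) = s e := by
  obtain ⟨l, hl, hn, hb⟩ := exists_simple_path h
  have h2 : PathTo s r (s e) (s e) (e :: l) := ⟨rfl, hl⟩
  obtain ⟨h3, h4⟩ := pathTo_cons_iff.1 h2
  exact ⟨e :: l, ⟨by simp, h3, h4, by rw [List.map_cons, List.nodup_cons]; exact ⟨hb, hn⟩⟩,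
    by simp, rfl⟩

theorem Q_of_linePoint (n : ℕ) : ∀ v : V, {w | Reaches s r v w}.ncard ≤ n →
    IsLinePoint s r v → Q K s r v := by
  induction n with
  | zero =>
    intro v hn
    have : {w | Reaches s r v w}.ncard ≠ 0 := by
      rw [Ne, Set.ncard_eq_zero (Set.toFinite _)]
      intro h
      have : v ∈ {w | Reaches s r v w} := Relation.ReflTransGen.refl
      rw [h] at this
      exact this
    omega
  | succ n ih =>
    intro v hn hv
    by_cases he : ∃ e, s e = v
    · obtain ⟨e, rfl⟩ := he
      have h0 := hv (s e) Relation.ReflTransGen.refl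
      have hstep : ∀ w, Reaches s r (r e) w → Reaches s r (s e) w := fun w hw =>
        Relation.ReflTransGen.head ⟨e, rfl, rfl⟩ hw
      apply Q_source e
      · intro f hf
        by_contra hne
        exact h0.1 ⟨f, e, hne, hf, rfl⟩
      · apply ih
        · have : {w | Reaches s r (r e) w}.ncard < {w | Reaches s r (s e) w}.ncard := by
            apply Set.ncard_lt_ncard _ (Set.toFinite _)
            refine ⟨hstep, fun h => ?_⟩
            have h1 : Reaches s r (r e) (s e) := h Relation.ReflTransGen.refl
            exact h0.2 (exists_cycle h1)
          omega
        · exact fun w hw => hv w (hstep w hw)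
    · exact Q_sink fun e h => he ⟨e, h⟩

theorem PathTo.reaches {b : V} : ∀ {l : List E} {a : V}, PathTo s r b a l →
    ∀ e ∈ l, Reaches s r a (s e)
  | [], _, _, e, he => by simp at he
  | f :: l, a, h, e, he => by
    obtain ⟨rfl, h2⟩ := h
    rcases List.mem_cons.1 he with rfl | he
    · exact Relation.ReflTransGen.refl
    · exact Relation.ReflTransGen.head ⟨f, rfl, rfl⟩ (PathTo.reaches h2 e he)

theorem Q_no_cycle {e : E} {l : List E} (hp : PathTo s r (s e) (s e) (e :: l))
    (hnd : ((e :: l).map s).Nodup) (hQ : Q K s r (s e)) : False := by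
  classical
  have huniq : ∀ f ∈ e :: l, ∀ g, s g = s f → g = f := by
    intro f hf g hg
    by_contra hne
    exact Q_no_bif (K := K) (s := s) (r := r) (Ne.symm hne) hg
      (Q_reaches (hp.reaches f hf) hQ)
  let σ : Equiv.Perm (ℕ ⊕ E) := Equiv.swap (Sum.inl 0) (Sum.inl 1)
  obtain ⟨b, inj, surj, hb⟩ := exists_branch s (fun f => if f = e then σ else 1)
  obtain ⟨ρ, hv, he⟩ := exists_rep K s r b inj surj
  have hel : e ∉ l := by
    intro h
    rw [List.map_cons, List.nodup_cons] at hnd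
    exact hnd.1 (List.mem_map_of_mem h)
  have htail : ∀ (l' : List E) (a w : V) (x : ℕ ⊕ E), (∀ f ∈ l', f ∈ l) → PathTo s r w a l' →
      ρ (pth K s r w l') (Finsupp.single (w, x) 1) = Finsupp.single (a, x) 1 := by
    intro l'
    induction l' with
    | nil =>
      intro a w x _ h
      have h : a = w := h
      subst h
      simp only [pth]
      rw [hv, if_pos rfl]
    | cons f l' ih =>
      intro a w x hsub h
      obtain ⟨rfl, h2⟩ := h
      have hfl : f ∈ l := hsub f (by simp)
      simp only [pth, map_mul, Module.End.mul_apply]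
      rw [ih (r f) w x (fun g hg => hsub g (by simp [hg])) h2, he, if_pos rfl,
        hb f x (huniq f (by simp [hfl])), if_neg (by rintro rfl; exact hel hfl)]
      rfl
  have hc : ∀ x, ρ (pth K s r (s e) (e :: l)) (Finsupp.single (s e, x) 1) =
      Finsupp.single (s e, σ x) 1 := by
    intro x
    simp only [pth, map_mul, Module.End.mul_apply]
    rw [htail l (r e) (s e) x (fun _ h => h) hp.2, he, if_pos rfl, hb e x (huniq e (by simp)),
      if_pos rfl]
  have hcw : ∀ l' : List E, pth K s r (s e) l' * vx K s r (s e) = pth K s r (s e) l' := by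
    intro l'
    induction l' with
    | nil => exact vx_idem _
    | cons f l' ih => simp only [pth, mul_assoc, ih]
  have hx : (vx K s r (s e) - pth K s r (s e) (e :: l)) * vx K s r (s e) =
      vx K s r (s e) - pth K s r (s e) (e :: l) := by
    rw [sub_mul, vx_idem, hcw]
  obtain ⟨a, ha⟩ := hQ (vx K s r (s e) - pth K s r (s e) (e :: l)) (by
    rw [hx]
    intro h
    rw [sub_eq_zero] at h
    have h1 := hc (Sum.inl 0)
    rw [← h, hv, if_pos rfl] at h1
    have h2 := Finsupp.single_left_injective (one_ne_zero) h1
    simp [σ] at h2)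
  rw [hx] at ha
  have h3 := hv (s e) (s e) (Sum.inl 2)
  rw [← ha, map_mul, Module.End.mul_apply, map_sub, LinearMap.sub_apply, hc, hv, if_pos rfl] at h3
  have h4 : σ (Sum.inl 2) = Sum.inl 2 := Equiv.swap_apply_of_ne_of_ne (by simp) (by simp)
  rw [h4, sub_self, map_zero] at h3
  exact one_ne_zero (Finsupp.single_eq_zero.1 h3.symm)

end graph

end LPAProof

/-- For a directed graph `E` with finitely many vertices, a field `K`
and a vertex `v`, the left ideal `L v` of the Leavitt path algebra `L = L_K(E)` is a
simple (minimal) left ideal — nonzero, and containing no left ideals except `0` and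
itself — if and only if `v` is a line point. -/
theorem lpa_span_vertex_simple_iff_linePoint (K V E : Type) [Field K] [Fintype V]
    (s r : E → V) (v : V) :
    (Submodule.span (LeavittPathAlgebra K V E s r) {lpaVertex K s r v} ≠ ⊥ ∧
      ∀ I : Submodule (LeavittPathAlgebra K V E s r) (LeavittPathAlgebra K V E s r),
        I ≤ Submodule.span (LeavittPathAlgebra K V E s r) {lpaVertex K s r v} →
          I = ⊥ ∨ I = Submodule.span (LeavittPathAlgebra K V E s r) {lpaVertex K s r v}) ↔
      IsLinePoint s r v := by
  rw [LPAProof.simple_iff]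
  constructor
  · intro hQ w hw
    have hQw := LPAProof.Q_reaches hw hQ
    constructor
    · rintro ⟨e, f, hef, rfl, hf⟩
      exact LPAProof.Q_no_bif hef hf hQw
    · rintro ⟨es, ⟨hne, hch, hcl, hnd⟩, hne', rfl⟩
      cases es with
      | nil => exact hne rfl
      | cons e l =>
        exact LPAProof.Q_no_cycle (LPAProof.pathTo_cons_iff.2 ⟨hch, hcl⟩) hnd hQw
  · exact LPAProof.Q_of_linePoint _ v le_rfl
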